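/- Let Δ ⊆ ℝ^n be a nonempty closed convex set, Ψ : ℝ^n → ℝ differentiable and σ_Ψ-strongly convex on Δ (D_Ψ(x,y) ≥ (σ_Ψ/2)‖x−y‖² on Δ, where D_Ψ(x,y) = Ψ(x) − Ψ(y) − ⟨∇Ψ(y), x−y⟩), and Φ : ℝ^n → ℝ convex differentiable with a minimizer μ* of Φ over Δ, Φ* = Φ(μ*). Let A > 0, B ≥ 0, φ* ≥ 0 with A Φ* + B ≥ 0 and ‖∇Φ(μ)‖² ≤ A Φ(μ) + B for all μ ∈ Δ. On a probability space with filtration (ℱ_t)_{t≥0}, let (μ^t)_{t≥1} be Δ-valued with μ^t ℱ_{t−1}-measurable, (ℓ^t)_{t≥1} be integrable ℝ^n-valued and ℱ_t-measurable, and (φ^t)_{t≥1} be integrable nonnegative real-valued and ℱ_t-measurable, such that almost surely for every t: (a) ⟨η_t ℓ^t + ∇Ψ(μ^{t+1}) − ∇Ψ(μ^t), μ^{t+1} − ν⟩ ≤ 0 for all ν ∈ Δ; (b) ‖ℓ^t‖² ≤ A φ^t + B; (c) ⟨μ* − μ^t, ℓ^t⟩ ≤ φ* − φ^t; (d) E[ℓ^t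 | ℱ_{t−1}] = ∇Φ(μ^t) and E[φ^t | ℱ_{t−1}] = Φ(μ^t). Assume the step sizes satisfy 0 < η_{t+1} ≤ η_t ≤ σ_Ψ/(2A), sup_t η_t Σ_{j<t} η_j < ∞ and Σ_t η_t² < ∞, and D_Ψ(μ*, μ^1) ≤ a† almost surely. Then there exists a finite constant C, not depending on T or δ, such that for every integer T ≥ 3 and every δ ∈ (0,1): P( max_{1 ≤ t ≤ T} ‖μ^t − μ*‖² ≤ C · log(T/δ) ) ≥ 1 − δ. -/

import Mathlib

open MeasureTheory
open scoped RealInnerProductSpace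

theorem aux_exp {y : ℝ} (hy : y ≤ 1) : Real.exp y ≤ 1 + y + y ^ 2 := by
  by_cases h : -1 ≤ y
  · have := Real.abs_exp_sub_one_sub_id_le (abs_le.2 ⟨h, hy⟩)
    have := (abs_le.1 this).2
    linarith
  · push Not at h
    have : Real.exp y ≤ 1 := Real.exp_le_one_iff.2 (by linarith)
    nlinarith

theorem aux_grad {n : ℕ} {Φ : EuclideanSpace ℝ (Fin n) → ℝ} {g x y : EuclideanSpace ℝ (Fin n)}
    (hc : ConvexOn ℝ Set.univ Φ) (hg : HasGradientAt Φ g x) :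
    ⟪y - x, g⟫ ≤ Φ y - Φ x := by
  have h1 : ConvexOn ℝ Set.univ (fun s : ℝ => Φ (AffineMap.lineMap x y s)) := by
    have := hc.comp_affineMap (AffineMap.lineMap x y : ℝ →ᵃ[ℝ] _)
    rw [Set.preimage_univ] at this
    exact this
  have h2 : HasDerivAt (fun s : ℝ => Φ (AffineMap.lineMap x y s)) ⟪y - x, g⟫ 0 := by
    have ha : HasDerivAt (fun s : ℝ => (AffineMap.lineMap x y s : EuclideanSpace ℝ (Fin n))) (y - x) 0 :=
      AffineMap.hasDerivAt_lineMap
    have hb : HasFDerivAt Φ (InnerProductSpace.toDual ℝ _ g)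
        (AffineMap.lineMap x y (0:ℝ)) := by
      simpa using hg.hasFDerivAt
    have := hb.comp_hasDerivAt (0:ℝ) ha
    rw [real_inner_comm]
    exact this
  have := h1.le_slope_of_hasDerivAt (Set.mem_univ 0) (Set.mem_univ 1) one_pos h2
  simpa [slope_def_field] using this

theorem aux_gradmeas {n : ℕ} {Φ : EuclideanSpace ℝ (Fin n) → ℝ}
    {g : EuclideanSpace ℝ (Fin n) → EuclideanSpace ℝ (Fin n)}
    (hg : ∀ x, HasGradientAt Φ (g x) x) : Measurable g := by
  have : g = fun x => (InnerProductSpace.toDual ℝ _).symm (fderiv ℝ Φ x) := by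
    funext x
    rw [(hg x).hasFDerivAt.fderiv]; simp
  rw [this]
  exact (LinearIsometryEquiv.continuous _).measurable.comp (measurable_fderiv ℝ Φ)

theorem aux_pull {Ω E : Type*} [NormedAddCommGroup E] [InnerProductSpace ℝ E] [CompleteSpace E]
    {m m0 : MeasurableSpace Ω} {P : Measure Ω} [IsProbabilityMeasure P] (hm : m ≤ m0)
    {g f h : Ω → E} (hg : StronglyMeasurable[m] g) {c : ℝ} (hc : ∀ᵐ ω ∂P, ‖g ω‖ ≤ c)
    (hf : Integrable f P) (hh : P[f|m] =ᵐ[P] h) :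
    Integrable (fun ω => ⟪g ω, f ω⟫) P ∧ Integrable (fun ω => ⟪g ω, h ω⟫) P ∧
      ∫ ω, ⟪g ω, f ω⟫ ∂P = ∫ ω, ⟪g ω, h ω⟫ ∂P := by
  have key : ∀ k : Ω → E, Integrable k P → Integrable (fun ω => ⟪g ω, k ω⟫) P := by
    intro k hk
    refine Integrable.mono' (hk.norm.const_mul c)
      ((hg.mono hm).aestronglyMeasurable.inner hk.1) ?_
    filter_upwards [hc] with ω hω
    exact (norm_inner_le_norm _ _).trans (by gcongr)
  have hhi : Integrable h P := integrable_condExp.congr hh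
  refine ⟨key f hf, key h hhi, ?_⟩
  have := condExp_bilin_of_stronglyMeasurable_left (innerSL ℝ (E := E)) hg (key f hf) hf
  rw [← integral_condExp hm]
  refine (integral_congr_ae this).trans ?_
  apply integral_congr_ae
  filter_upwards [hh] with ω hω
  simp only [hω]
  rfl

theorem aux_step {Ω E : Type*} [NormedAddCommGroup E] [InnerProductSpace ℝ E] [CompleteSpace E]
    {m m0 : MeasurableSpace Ω} {P : Measure Ω} [IsProbabilityMeasure P] (hm : m ≤ m0)
    {g0 g2 f2 h2 Y Y2 : Ω → ℝ} {g1 f1 h1 : Ω → E}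
    (hg0 : StronglyMeasurable[m] g0) (hg1 : StronglyMeasurable[m] g1)
    (hg2 : StronglyMeasurable[m] g2) {c0 c1 c2 : ℝ} (hc0 : ∀ᵐ ω ∂P, ‖g0 ω‖ ≤ c0)
    (hc1 : ∀ᵐ ω ∂P, ‖g1 ω‖ ≤ c1) (hc2 : ∀ᵐ ω ∂P, ‖g2 ω‖ ≤ c2)
    (hf1 : Integrable f1 P) (hh1 : P[f1|m] =ᵐ[P] h1)
    (hf2 : Integrable f2 P) (hh2 : P[f2|m] =ᵐ[P] h2)
    (hY0 : ∀ ω, 0 ≤ Y ω) (hY2 : Integrable Y2 P)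
    (hY : ∀ᵐ ω ∂P, Y ω ≤ g0 ω + ⟪g1 ω, f1 ω⟫ + g2 ω * f2 ω)
    (hYY : ∀ᵐ ω ∂P, g0 ω + ⟪g1 ω, h1 ω⟫ + g2 ω * h2 ω ≤ Y2 ω) :
    ∫ ω, Y ω ∂P ≤ ∫ ω, Y2 ω ∂P := by
  obtain ⟨a1, b1, e1⟩ := aux_pull hm hg1 hc1 hf1 hh1
  obtain ⟨a2, b2, e2⟩ := aux_pull hm hg2 hc2 hf2 hh2
  have i0 : Integrable g0 P := Integrable.of_bound (hg0.mono hm).aestronglyMeasurable c0 hc0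
  simp only [RCLike.inner_apply, conj_trivial] at a2 b2 e2
  simp only [mul_comm _ (g2 _)] at a2 b2 e2
  calc ∫ ω, Y ω ∂P ≤ ∫ ω, (g0 ω + ⟪g1 ω, f1 ω⟫ + g2 ω * f2 ω) ∂P :=
        integral_mono_of_nonneg (.of_forall hY0) ((i0.add a1).add a2) hY
    _ = ∫ ω, (g0 ω + ⟪g1 ω, h1 ω⟫ + g2 ω * h2 ω) ∂P := by
        have j1 : Integrable (fun ω => g0 ω + ⟪g1 ω, f1 ω⟫) P := i0.add a1
        have j2 : Integrable (fun ω => g0 ω + ⟪g1 ω, h1 ω⟫) P := i0.add b1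
        rw [integral_add j1 a2, integral_add i0 a1, integral_add j2 b2,
          integral_add i0 b1, e1, e2]
    _ ≤ _ := integral_mono_ae ((i0.add b1).add b2) hY2 hYY

/-- deterministic one-step inequality -/
theorem aux_md {E : Type*} [NormedAddCommGroup E] [InnerProductSpace ℝ E]
    {Ψs Ψ0 Ψ1 σ η : ℝ} {s x y g0 g1 l : E} (hσ : 0 < σ) 
    (h : ⟪η • l + g1 - g0, y - s⟫ ≤ 0)
    (hs : σ / 2 * ‖y - x‖ ^ 2 ≤ Ψ1 - Ψ0 - ⟪g0, y - x⟫) :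
    Ψs - Ψ1 - ⟪g1, s - y⟫ ≤ (Ψs - Ψ0 - ⟪g0, s - x⟫) + (η * ⟪s - x, l⟫ + η ^ 2 / (2 * σ) * ‖l‖ ^ 2) := by
  have h1 : -(η * ⟪l, y - x⟫) ≤ σ / 2 * ‖y - x‖ ^ 2 + η ^ 2 / (2 * σ) * ‖l‖ ^ 2 := by
    have a := abs_real_inner_le_norm l (y - x)
    have b : -(η * ⟪l, y - x⟫) ≤ |η| * (‖l‖ * ‖y - x‖) := by
      calc _ ≤ |η * ⟪l, y - x⟫| := neg_le_abs _
        _ = |η| * |⟪l, y - x⟫| := abs_mul _ _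
        _ ≤ _ := by gcongr
    refine b.trans ?_
    have c : σ / 2 * ‖y - x‖ ^ 2 + η ^ 2 / (2 * σ) * ‖l‖ ^ 2 - |η| * (‖l‖ * ‖y - x‖)
      = (σ * ‖y - x‖ - |η| * ‖l‖) ^ 2 / (2 * σ) := by
      rw [← sq_abs η]; field_simp; ring
    have : 0 ≤ (σ * ‖y - x‖ - |η| * ‖l‖) ^ 2 / (2 * σ) := by positivity
    linarith
  simp only [inner_add_left, inner_sub_left, inner_sub_right, real_inner_smul_left] at *
  rw [real_inner_comm s l, real_inner_comm x l] at *
  linarith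

theorem aux_Xle {A B σ η u p q : ℝ} (hσ : 0 < σ) (hA : 0 < A) (hη : 0 < η)
    (hηle : η ≤ σ / (2 * A)) (hp : 0 ≤ p) (hu : u ≤ q - p) :
    η * u + η ^ 2 / (2 * σ) * (A * p + B) ≤ η * q + B / (2 * σ) * η ^ 2 - 3 / 4 * (η * p) := by
  have h1 : η * (2 * A) ≤ σ := (le_div_iff₀ (by positivity)).1 hηle
  have h2 : η ^ 2 / (2 * σ) * (A * p) ≤ η * p / 4 := by
    rw [div_mul_eq_mul_div, div_le_div_iff₀ (by positivity) (by norm_num)]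
    nlinarith [mul_nonneg (mul_nonneg hη.le hp) (sub_nonneg.2 h1)]
  have h3 : η * u ≤ η * (q - p) := by gcongr
  have h4 : η ^ 2 / (2 * σ) * B = B / (2 * σ) * η ^ 2 := by ring
  linarith

theorem aux_pt {d d' l η u z σ G K : ℝ} (hσ : 0 < σ) (hl : 0 < l)
    (hz : 0 ≤ z)
    (h : d' ≤ d + (η * u + η ^ 2 / (2 * σ) * z)) (hu : u ^ 2 ≤ 2 / σ * d * z)
    (hX : η * u + η ^ 2 / (2 * σ) * z ≤ K) (hG : η ^ 2 * z ≤ G) (hK : l * K ≤ 1) :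
    Real.exp (l * d') ≤ Real.exp (l * d) * (1 + l * (η * u + η ^ 2 / (2 * σ) * z)
      + l ^ 2 * (η ^ 2 * z * (4 / σ * d + G / (2 * σ ^ 2)))) := by
  set X := η * u + η ^ 2 / (2 * σ) * z with hXd
  have h1 : X ^ 2 ≤ η ^ 2 * z * (4 / σ * d + G / (2 * σ ^ 2)) := by
    have a : X ^ 2 ≤ 2 * (η ^ 2 * u ^ 2) + 2 * (η ^ 2 / (2 * σ) * z) ^ 2 := by
      rw [hXd]; nlinarith [sq_nonneg (η * u - η ^ 2 / (2 * σ) * z)]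
    have b : η ^ 2 * u ^ 2 ≤ η ^ 2 * (2 / σ * d * z) := by gcongr
    have c : (η ^ 2 / (2 * σ) * z) ^ 2 ≤ η ^ 2 * z * G / (4 * σ ^ 2) := by
      have : (η ^ 2 / (2 * σ) * z) ^ 2 = η ^ 2 * z * (η ^ 2 * z) / (4 * σ ^ 2) := by
        field_simp; ring
      rw [this]; gcongr
    have e : η ^ 2 * z * (4 / σ * d + G / (2 * σ ^ 2)) =
      2 * (η ^ 2 * (2 / σ * d * z)) + 2 * (η ^ 2 * z * G / (4 * σ ^ 2)) := by
      field_simp; ring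
    linarith
  calc Real.exp (l * d') ≤ Real.exp (l * d + l * X) := by
        apply Real.exp_le_exp.2; nlinarith
    _ = Real.exp (l * d) * Real.exp (l * X) := Real.exp_add _ _
    _ ≤ Real.exp (l * d) * (1 + l * X + (l * X) ^ 2) := by
        gcongr; exact aux_exp ((mul_le_mul_of_nonneg_left hX hl.le).trans hK)
    _ ≤ _ := by
        rw [mul_pow]; gcongr

theorem aux_mean {A B σ η u p ps d l G3 G H b : ℝ} (hσ : 0 < σ) (hA : 0 < A) (hη : 0 < η)
    (hηle : η ≤ σ / (2 * A)) (hηH : η ≤ H) (hp : ps ≤ p) (hu : u ≤ ps - p)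
    (hb : b = A * ps + B) (hb0 : 0 ≤ b) (hl : 0 < l) (hl1 : l ≤ 1) (hG3 : 0 ≤ G3)
    (hd : η * d ≤ G) (hlG : l * (A * (4 / σ * G + G3 * H)) ≤ 3 / 4) :
    1 + l * (η * u + η ^ 2 / (2 * σ) * (A * p + B))
      + l ^ 2 * (η ^ 2 * (A * p + B) * (4 / σ * d + G3)) ≤
    Real.exp (η ^ 2 * ((b / (2 * σ) + b * G3) + l ^ 2 * (4 / σ * b) * d)) := by
  have h1 := aux_Xle (B := b) (p := p - ps) (u := u) (q := 0) hσ hA hη hηle (by linarith) (by linarith)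
  have e1 : A * p + B = A * (p - ps) + b := by rw [hb]; ring
  have h2 : η * (4 / σ * d + G3) ≤ 4 / σ * G + G3 * H := by
    have : 4 / σ * (η * d) ≤ 4 / σ * G := by gcongr
    have : G3 * η ≤ G3 * H := by gcongr
    linarith
  have h3 : l ^ 2 * (η ^ 2 * (A * (p - ps)) * (4 / σ * d + G3)) ≤ l * (3 / 4 * (η * (p - ps))) := by
    have q0 : 0 ≤ l * (η * (p - ps)) := mul_nonneg hl.le (mul_nonneg hη.le (by linarith))
    have : l * A * (η * (4 / σ * d + G3)) ≤ 3 / 4 := by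
      refine le_trans ?_ hlG
      rw [mul_assoc]; gcongr
    have := mul_le_mul_of_nonneg_left this q0
    linarith
  have h4 : l * (b / (2 * σ) * η ^ 2) ≤ η ^ 2 * (b / (2 * σ)) := by
    have : 0 ≤ b / (2 * σ) * η ^ 2 := by positivity
    nlinarith
  have h5 : l ^ 2 * (η ^ 2 * (b * G3)) ≤ η ^ 2 * (b * G3) := by
    have : 0 ≤ η ^ 2 * (b * G3) := by positivity
    have : l ^ 2 ≤ 1 := by nlinarith
    nlinarith
  have h6 := mul_le_mul_of_nonneg_left h1 hl.le
  rw [e1]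
  refine le_trans ?_ (Real.add_one_le_exp _)
  linarith

set_option maxHeartbeats 4000000 in
/-- Theorem 1 of the paper: a high-probability uniform bound on the Euclidean
distance of post-attack mirror-descent iterates from the mean Wardrop
equilibrium `μ*`: there is a constant `C` such that for every horizon `T ≥ 3`
and every `δ ∈ (0,1)`, with probability at least `1 − δ`,
`max_{1 ≤ t ≤ T} ‖μ^t − μ*‖² ≤ C log(T/δ)`. -/
theorem md_high_probability_distance_bound
    {n : ℕ} {Ω : Type*} {m0 : MeasurableSpace Ω}
    (P : Measure Ω) [IsProbabilityMeasure P] (ℱ : Filtration ℕ m0)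
    (Δ : Set (EuclideanSpace ℝ (Fin n)))
    (hΔne : Δ.Nonempty) (hΔclosed : IsClosed Δ) (hΔconv : Convex ℝ Δ)
    (Ψ : EuclideanSpace ℝ (Fin n) → ℝ)
    (gΨ : EuclideanSpace ℝ (Fin n) → EuclideanSpace ℝ (Fin n))
    (hΨ : ∀ x, HasGradientAt Ψ (gΨ x) x)
    (D : EuclideanSpace ℝ (Fin n) → EuclideanSpace ℝ (Fin n) → ℝ)
    (hD : ∀ x y, D x y = Ψ x - Ψ y - ⟪gΨ y, x - y⟫)
    (σΨ : ℝ) (hσΨ : 0 < σΨ)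
    (hstrong : ∀ x ∈ Δ, ∀ y ∈ Δ, σΨ / 2 * ‖x - y‖ ^ 2 ≤ D x y)
    (Φ : EuclideanSpace ℝ (Fin n) → ℝ)
    (gΦ : EuclideanSpace ℝ (Fin n) → EuclideanSpace ℝ (Fin n))
    (hΦconv : ConvexOn ℝ Set.univ Φ)
    (hΦgrad : ∀ x, HasGradientAt Φ (gΦ x) x)
    (μstar : EuclideanSpace ℝ (Fin n)) (hμstar : μstar ∈ Δ)
    (hmin : ∀ ν ∈ Δ, Φ μstar ≤ Φ ν)
    (Φstar : ℝ) (hΦstar : Φstar = Φ μstar)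
    (A B φstar : ℝ) (hA : 0 < A) (hB : 0 ≤ B) (hφstar : 0 ≤ φstar)
    (hABΦ : 0 ≤ A * Φstar + B)
    (hgrowthΦ : ∀ ν ∈ Δ, ‖gΦ ν‖ ^ 2 ≤ A * Φ ν + B)
    (μ : ℕ → Ω → EuclideanSpace ℝ (Fin n))
    (ℓ : ℕ → Ω → EuclideanSpace ℝ (Fin n))
    (φ : ℕ → Ω → ℝ) (η : ℕ → ℝ)
    (hμΔ : ∀ t ≥ 1, ∀ ω, μ t ω ∈ Δ)
    (hμmeas : ∀ t ≥ 1, StronglyMeasurable[ℱ (t - 1)] (μ t))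
    (hℓmeas : ∀ t ≥ 1, StronglyMeasurable[ℱ t] (ℓ t))
    (hℓint : ∀ t ≥ 1, Integrable (ℓ t) P)
    (hφmeas : ∀ t ≥ 1, StronglyMeasurable[ℱ t] (φ t))
    (hφint : ∀ t ≥ 1, Integrable (φ t) P)
    (hφpos : ∀ t ≥ 1, ∀ ω, 0 ≤ φ t ω)
    (habc : ∀ᵐ ω ∂P, ∀ t ≥ 1,
      (∀ ν ∈ Δ, ⟪η t • ℓ t ω + gΨ (μ (t + 1) ω) - gΨ (μ t ω), μ (t + 1) ω - ν⟫ ≤ 0) ∧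
      ‖ℓ t ω‖ ^ 2 ≤ A * φ t ω + B ∧
      ⟪μstar - μ t ω, ℓ t ω⟫ ≤ φstar - φ t ω)
    (hcondℓ : ∀ t ≥ 1, P[ℓ t|ℱ (t - 1)] =ᵐ[P] fun ω => gΦ (μ t ω))
    (hcondφ : ∀ t ≥ 1, P[φ t|ℱ (t - 1)] =ᵐ[P] fun ω => Φ (μ t ω))
    (hηpos : ∀ t ≥ 1, 0 < η t)
    (hηdec : ∀ t ≥ 1, η (t + 1) ≤ η t)
    (hηle : ∀ t ≥ 1, η t ≤ σΨ / (2 * A))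
    (hηprod : ∃ c : ℝ, ∀ t ≥ 1, η t * ∑ j ∈ Finset.Ico 1 t, η j ≤ c)
    (hηsq : Summable fun t => η t ^ 2)
    (adag : ℝ) (hadag : ∀ᵐ ω ∂P, D μstar (μ 1 ω) ≤ adag) :
    ∃ C : ℝ, ∀ T : ℕ, 3 ≤ T → ∀ δ : ℝ, 0 < δ → δ < 1 →
      ENNReal.ofReal (1 - δ) ≤
        P {ω | ∀ t ∈ Finset.Icc 1 T,
          ‖μ t ω - μstar‖ ^ 2 ≤ C * Real.log (T / δ)} := by
  classical
  -- constants
  obtain ⟨c, hc⟩ := hηprod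
  set H := η 1 with hH
  have hHpos : 0 < H := hηpos 1 le_rfl
  have hηH : ∀ t ≥ 1, η t ≤ H := by
    intro t ht
    induction t, ht using Nat.le_induction with
    | base => exact le_rfl
    | succ k hk ih => exact (hηdec k hk).trans ih
  have hc0 : 0 ≤ c := by simpa using hc 1 le_rfl
  set S := ∑' t, η t ^ 2 with hS
  have hS0 : 0 ≤ S := tsum_nonneg fun _ => sq_nonneg _
  have hSle : ∀ t, ∑ j ∈ Finset.Ico 1 t, η j ^ 2 ≤ S := fun t =>
    hηsq.sum_le_tsum _ (fun _ _ => sq_nonneg _)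
  have hDpos : ∀ x ∈ Δ, ∀ y ∈ Δ, 0 ≤ D x y := fun x hx y hy =>
    le_trans (by positivity) (hstrong x hx y hy)
  have hadag0 : 0 ≤ adag := by
    obtain ⟨ω, hω⟩ := hadag.exists
    exact (hDpos _ hμstar _ (hμΔ 1 le_rfl ω)).trans hω
  set d : ℕ → Ω → ℝ := fun t ω => D μstar (μ t ω) with hd
  have hd0 : ∀ t ≥ 1, ∀ ω, 0 ≤ d t ω := fun t ht ω => hDpos _ hμstar _ (hμΔ t ht ω)
  have hdnorm : ∀ t ≥ 1, ∀ ω, σΨ / 2 * ‖μstar - μ t ω‖ ^ 2 ≤ d t ω := fun t ht ω =>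
    hstrong _ hμstar _ (hμΔ t ht ω)
  -- measurability of `d`
  have hDmeas : Measurable fun y => D μstar y := by
    have h1 : Measurable gΨ := aux_gradmeas hΨ
    have h2 : Continuous Ψ := continuous_iff_continuousAt.2 fun x =>
      (hΨ x).hasFDerivAt.continuousAt
    have h3 := h2.measurable
    simp only [hD]
    exact (h3.const_sub _).sub (h1.inner (measurable_id.const_sub _))
  have hdmeas : ∀ t ≥ 1, StronglyMeasurable[ℱ (t - 1)] (d t) := fun t ht =>
    (hDmeas.comp (hμmeas t ht).measurable).stronglyMeasurable
  -- one-step inequality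
  have hstep : ∀ᵐ ω ∂P, ∀ t ≥ 1, d (t + 1) ω ≤ d t ω +
      (η t * ⟪μstar - μ t ω, ℓ t ω⟫ + η t ^ 2 / (2 * σΨ) * (A * φ t ω + B)) := by
    filter_upwards [habc] with ω hω t ht
    obtain ⟨h1, h2, h3⟩ := hω t ht
    have h4 := hstrong _ (hμΔ (t + 1) (by omega) ω) _ (hμΔ t ht ω)
    rw [hD] at h4
    have h5 := aux_md (Ψs := Ψ μstar) hσΨ (h1 μstar hμstar) h4
    simp only [hd, hD]
    refine h5.trans ?_
    gcongr
  have hXle : ∀ᵐ ω ∂P, ∀ t ≥ 1,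
      η t * ⟪μstar - μ t ω, ℓ t ω⟫ + η t ^ 2 / (2 * σΨ) * (A * φ t ω + B) ≤
      η t * φstar + B / (2 * σΨ) * η t ^ 2 - 3 / 4 * (η t * φ t ω) := by
    filter_upwards [habc] with ω hω t ht
    exact aux_Xle hσΨ hA (hηpos t ht) (hηle t ht) (hφpos t ht ω) (hω t ht).2.2
  -- deterministic growth bound
  set R : ℕ → ℝ := fun t => adag + φstar * ∑ j ∈ Finset.Ico 1 t, η j +
    B / (2 * σΨ) * ∑ j ∈ Finset.Ico 1 t, η j ^ 2 with hR
  have hdR : ∀ᵐ ω ∂P, ∀ t ≥ 1, d t ω ≤ R t := by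
    filter_upwards [hstep, hXle, hadag] with ω h1 h2 h3 t ht
    induction t, ht using Nat.le_induction with
    | base => simpa [hR, hd] using h3
    | succ k hk ih =>
      have a := h1 k hk
      have b := h2 k hk
      have e : 0 ≤ η k * φ k ω := mul_nonneg (hηpos k hk).le (hφpos k hk ω)
      simp only [hR] at ih ⊢
      rw [Finset.sum_Ico_succ_top hk, Finset.sum_Ico_succ_top hk]
      linarith
  set G := H * adag + φstar * c + H * (B / (2 * σΨ) * S) with hG
  have hG0 : 0 ≤ G := by positivity
  have hdG : ∀ᵐ ω ∂P, ∀ t ≥ 1, η t * d t ω ≤ G := by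
    filter_upwards [hdR] with ω h1 t ht
    have hp := hηpos t ht
    calc η t * d t ω ≤ η t * R t := by gcongr; exact h1 t ht
      _ = η t * adag + φstar * (η t * ∑ j ∈ Finset.Ico 1 t, η j) +
          η t * (B / (2 * σΨ) * ∑ j ∈ Finset.Ico 1 t, η j ^ 2) := by simp only [hR]; ring
      _ ≤ G := by
        rw [hG]
        gcongr
        · exact hηH t ht
        · exact hc t ht
        · exact hηH t ht
        · exact hSle t
  set K := H * φstar + B / (2 * σΨ) * H ^ 2 with hK
  have hK0 : 0 ≤ K := by positivity
  have hXK : ∀ᵐ ω ∂P, ∀ t ≥ 1,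
      η t * ⟪μstar - μ t ω, ℓ t ω⟫ + η t ^ 2 / (2 * σΨ) * (A * φ t ω + B) ≤ K := by
    filter_upwards [hXle] with ω h1 t ht
    have hp := hηpos t ht
    have e : 0 ≤ η t * φ t ω := mul_nonneg hp.le (hφpos t ht ω)
    have e2 : η t * φstar + B / (2 * σΨ) * η t ^ 2 ≤ K := by
      rw [hK]; gcongr
      · exact hηH t ht
      · exact hηH t ht
    linarith [h1 t ht]
  set G2 := A * (4 / 3 * (G + H * K)) + H ^ 2 * B with hG2
  have hG20 : 0 ≤ G2 := by positivity
  have hzG : ∀ᵐ ω ∂P, ∀ t ≥ 1, η t ^ 2 * (A * φ t ω + B) ≤ G2 := by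
    filter_upwards [hXle, hstep, hdG] with ω h1 h2 h3 t ht
    have hp := hηpos t ht
    have e2 : η t * φstar + B / (2 * σΨ) * η t ^ 2 ≤ K := by
      rw [hK]; gcongr
      · exact hηH t ht
      · exact hηH t ht
    have a : 3 / 4 * (η t * φ t ω) ≤ d t ω + K := by
      linarith [h1 t ht, h2 t ht, hd0 (t + 1) (by omega) ω]
    have b : η t * (3 / 4 * (η t * φ t ω)) ≤ η t * (d t ω + K) := by gcongr
    have b2 : η t * K ≤ H * K := by gcongr; exact hηH t ht
    have b3 : η t ^ 2 * φ t ω ≤ 4 / 3 * (G + H * K) := by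
      linarith [h3 t ht]
    have b4 : η t ^ 2 * B ≤ H ^ 2 * B := by gcongr; exact hηH t ht
    have b5 := mul_le_mul_of_nonneg_left b3 hA.le
    rw [hG2]; linarith
  set G3 := G2 / (2 * σΨ ^ 2) with hG3
  have hG30 : 0 ≤ G3 := by positivity
  set b := A * Φstar + B with hb
  set k1 := b / (2 * σΨ) + b * G3 with hk1
  set k2 := 4 / σΨ * b with hk2
  have hk10 : 0 ≤ k1 := by positivity
  have hk20 : 0 ≤ k2 := by positivity
  set W := A * (4 / σΨ * G + G3 * H) with hW
  have hW0 : 0 ≤ W := by positivity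
  set l0 := 1 / (1 + K + 2 * W + 2 * (k2 * S)) with hl0
  have hden : 0 < 1 + K + 2 * W + 2 * (k2 * S) := by positivity
  have hl0pos : 0 < l0 := by positivity
  have hl0eq : l0 * (1 + K + 2 * W + 2 * (k2 * S)) = 1 := by
    rw [hl0]; field_simp
  have hkS : 0 ≤ k2 * S := by positivity
  have hp1 := mul_nonneg hl0pos.le hK0
  have hp2 := mul_nonneg hl0pos.le hW0
  have hp3 := mul_nonneg hl0pos.le hkS
  have hl0eq' : l0 + l0 * K + 2 * (l0 * W) + 2 * (l0 * (k2 * S)) = 1 := by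
    rw [← hl0eq]; ring
  clear_value l0 W k2 k1 G3 G2 K G S b H d R
  have hl01 : l0 ≤ 1 := by linarith
  have hl0K : l0 * K ≤ 1 := by linarith
  have hl0W : l0 * W ≤ 3 / 4 := by linarith
  have hl0S : l0 * (k2 * S) ≤ 1 / 2 := by linarith
  set L : ℕ → ℝ := fun t => l0 - l0 ^ 2 * k2 * ∑ j ∈ Finset.Ico 1 t, η j ^ 2 with hL
  have hLle : ∀ t, L t ≤ l0 := fun t => by
    have : 0 ≤ l0 ^ 2 * k2 * ∑ j ∈ Finset.Ico 1 t, η j ^ 2 := by positivity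
    simp only [hL]; linarith
  have hLge : ∀ t, l0 / 2 ≤ L t := fun t => by
    have h1 : l0 ^ 2 * k2 * ∑ j ∈ Finset.Ico 1 t, η j ^ 2 ≤ l0 ^ 2 * k2 * S := by
      gcongr; exact hSle t
    have h2 := mul_le_mul_of_nonneg_left hl0S hl0pos.le
    simp only [hL]; linarith
  have hLpos : ∀ t, 0 < L t := fun t => by linarith [hLge t]
  -- exponential moments
  have hexpint : ∀ t ≥ 1, ∀ l : ℝ, 0 < l → Integrable (fun ω => Real.exp (l * d t ω)) P := by
    intro t ht l hl
    refine Integrable.of_bound (C := Real.exp (l * R t)) ?_ ?_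
    · exact (Real.continuous_exp.comp_stronglyMeasurable
        (((hdmeas t ht).mono (ℱ.le _)).const_mul l)).aestronglyMeasurable
    · filter_upwards [hdR] with ω h
      rw [Real.norm_eq_abs, Real.abs_exp]
      gcongr; exact h t ht
  have hmgf : ∀ t ≥ 1, ∫ ω, Real.exp (L t * d t ω) ∂P ≤
      Real.exp (adag + k1 * ∑ j ∈ Finset.Ico 1 t, η j ^ 2) := by
    intro t ht
    induction t, ht using Nat.le_induction with
    | base =>
      have : ∫ ω, Real.exp (L 1 * d 1 ω) ∂P ≤ ∫ ω, Real.exp adag ∂P := by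
        refine integral_mono_ae (hexpint 1 le_rfl _ (hLpos 1)) (integrable_const _) ?_
        filter_upwards [hadag] with ω h
        apply Real.exp_le_exp.2
        calc L 1 * d 1 ω ≤ 1 * d 1 ω := by
              gcongr
              · exact hd0 1 le_rfl ω
              · exact (hLle 1).trans hl01
          _ ≤ adag := by rw [hd]; simpa using h
      simpa using this
    | succ t ht ih =>
      have hp := hηpos t ht
      set l := L (t + 1) with hl
      have hlpos : 0 < l := hLpos _
      have hll0 : l ≤ l0 := hLle _
      have hLrec : l + l0 ^ 2 * k2 * η t ^ 2 = L t := by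
        simp only [hl, hL]; rw [Finset.sum_Ico_succ_top ht]; ring
      have hmd := hdmeas t ht
      have hme : StronglyMeasurable[ℱ (t - 1)] (fun ω => Real.exp (l * d t ω)) :=
        Real.continuous_exp.comp_stronglyMeasurable (hmd.const_mul l)
      have hmq : StronglyMeasurable[ℱ (t - 1)] (fun ω => 4 / σΨ * d t ω + G3) :=
        (hmd.const_mul _).add stronglyMeasurable_const
      have key : ∫ ω, Real.exp (l * d (t + 1) ω) ∂P ≤
          ∫ ω, Real.exp (L t * d t ω) * Real.exp (k1 * η t ^ 2) ∂P := by
        refine aux_step (ℱ.le (t - 1))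
          (g0 := fun ω => Real.exp (l * d t ω) * (1 + l * (η t ^ 2 / (2 * σΨ) * B)
            + (l ^ 2 * η t ^ 2 * B) * (4 / σΨ * d t ω + G3)))
          (g1 := fun ω => (Real.exp (l * d t ω) * (l * η t)) • (μstar - μ t ω))
          (g2 := fun ω => Real.exp (l * d t ω) * (l * (η t ^ 2 / (2 * σΨ) * A)
            + (l ^ 2 * η t ^ 2 * A) * (4 / σΨ * d t ω + G3)))
          (c0 := Real.exp (l * R t) * (1 + l * (η t ^ 2 / (2 * σΨ) * B)
            + (l ^ 2 * η t ^ 2 * B) * (4 / σΨ * R t + G3)))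
          (c1 := Real.exp (l * R t) * (l * η t) * (1 + 2 / σΨ * R t))
          (c2 := Real.exp (l * R t) * (l * (η t ^ 2 / (2 * σΨ) * A)
            + (l ^ 2 * η t ^ 2 * A) * (4 / σΨ * R t + G3)))
          (hme.mul (stronglyMeasurable_const.add (hmq.const_mul _)))
          ((hme.mul_const _).smul (stronglyMeasurable_const.sub (hμmeas t ht)))
          (hme.mul (stronglyMeasurable_const.add (hmq.const_mul _))) ?_ ?_ ?_
          (hℓint t ht) (hcondℓ t ht) (hφint t ht) (hcondφ t ht)
          (fun ω => (Real.exp_pos _).le) ((hexpint t ht _ (hLpos t)).mul_const _) ?_ ?_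
        · filter_upwards [hdR] with ω h
          have h0 := hd0 t ht ω
          have h1 := h t ht
          rw [Real.norm_of_nonneg (by positivity)]
          gcongr
        · filter_upwards [hdR] with ω h
          have h0 := hd0 t ht ω
          have h1 := h t ht
          rw [norm_smul, Real.norm_of_nonneg (by positivity)]
          have h2 : ‖μstar - μ t ω‖ ≤ 1 + 2 / σΨ * R t := by
            have a : ‖μstar - μ t ω‖ ^ 2 ≤ 2 / σΨ * R t := by
              rw [div_mul_eq_mul_div, le_div_iff₀ hσΨ]
              linarith [hdnorm t ht ω]
            nlinarith [sq_nonneg (‖μstar - μ t ω‖ - 1)]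
          gcongr
        · filter_upwards [hdR] with ω h
          have h0 := hd0 t ht ω
          have h1 := h t ht
          rw [Real.norm_of_nonneg (by positivity)]
          gcongr
        · filter_upwards [habc, hstep, hXK, hzG] with ω h1 h2 h3 h4
          obtain ⟨-, h5, -⟩ := h1 t ht
          have hz : 0 ≤ A * φ t ω + B := by
            have := hφpos t ht ω
            positivity
          have hu : ⟪μstar - μ t ω, ℓ t ω⟫ ^ 2 ≤ 2 / σΨ * d t ω * (A * φ t ω + B) := by
            have a : ‖μstar - μ t ω‖ ^ 2 ≤ 2 / σΨ * d t ω := by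
              rw [div_mul_eq_mul_div, le_div_iff₀ hσΨ]
              linarith [hdnorm t ht ω]
            have := abs_real_inner_le_norm (μstar - μ t ω) (ℓ t ω)
            rw [← sq_abs]
            calc _ ≤ (‖μstar - μ t ω‖ * ‖ℓ t ω‖) ^ 2 := by gcongr
              _ = ‖μstar - μ t ω‖ ^ 2 * ‖ℓ t ω‖ ^ 2 := mul_pow _ _ _
              _ ≤ _ := mul_le_mul a h5 (sq_nonneg _) ((sq_nonneg _).trans a)
          have h6 := aux_pt hσΨ hlpos hz (h2 t ht) hu (h3 t ht) (h4 t ht)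
            ((mul_le_mul_of_nonneg_right hll0 hK0).trans hl0K)
          refine h6.trans (le_of_eq ?_)
          rw [real_inner_smul_left, ← hG3]
          ring
        · filter_upwards [hdG] with ω h1
          have h0 := hd0 t ht ω
          have h2 := aux_mean (u := ⟪μstar - μ t ω, gΦ (μ t ω)⟫) (p := Φ (μ t ω)) (ps := Φstar)
            hσΨ hA hp (hηle t ht) (hηH t ht)
            (by rw [hΦstar]; exact hmin _ (hμΔ t ht ω))
            (by rw [hΦstar]; exact aux_grad hΦconv (hΦgrad _))
            hb hABΦ hlpos (hll0.trans hl01) hG30 (h1 t ht)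
            (by rw [← hW]; exact (mul_le_mul_of_nonneg_right hll0 hW0).trans hl0W)
          have h3 := mul_le_mul_of_nonneg_left h2 (Real.exp_pos (l * d t ω)).le
          refine le_trans (le_of_eq ?_) (h3.trans ?_)
          · rw [real_inner_smul_left]
            ring
          · rw [← Real.exp_add, ← Real.exp_add]
            apply Real.exp_le_exp.2
            have a : l ^ 2 * (k2 * η t ^ 2 * d t ω) ≤ l0 ^ 2 * (k2 * η t ^ 2 * d t ω) := by
              gcongr
            rw [← hLrec, ← hk1, ← hk2]
            linarith
      rw [integral_mul_const] at key
      refine key.trans ?_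
      rw [Finset.sum_Ico_succ_top ht, mul_add, ← add_assoc, Real.exp_add]
      gcongr
  -- conclusion
  set M := adag + k1 * S with hM
  have hM0 : 0 ≤ M := by positivity
  refine ⟨2 / σΨ * (2 / l0 * (1 + M)), fun T hT δ hδ hδ1 => ?_⟩
  have hTpos : (0 : ℝ) < T := by exact_mod_cast (by omega : 0 < T)
  have hT3 : (3 : ℝ) ≤ T := by exact_mod_cast hT
  set Λ := Real.log (T / δ) with hΛ
  have hΛ1 : 1 ≤ Λ := by
    rw [hΛ, Real.le_log_iff_exp_le (by positivity)]
    rw [le_div_iff₀ hδ]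
    have := Real.exp_one_lt_d9
    nlinarith
  set x := 2 / l0 * (1 + M) * Λ with hx
  have hbad : ∀ t ∈ Finset.Icc 1 T, P {ω | x < d t ω} ≤ ENNReal.ofReal (δ / T) := by
    intro t htT
    have ht : t ≥ 1 := (Finset.mem_Icc.1 htT).1
    have h1 := mul_meas_ge_le_integral_of_nonneg (μ := P)
      (f := fun ω => Real.exp (L t * d t ω)) (.of_forall fun ω => (Real.exp_pos _).le)
      (hexpint t ht _ (hLpos t)) (Real.exp (M + Λ))
    have h2 : ∫ ω, Real.exp (L t * d t ω) ∂P ≤ Real.exp M := by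
      refine (hmgf t ht).trans (Real.exp_le_exp.2 ?_)
      rw [hM]; gcongr; exact hSle t
    have h3 : P.real {ω | Real.exp (M + Λ) ≤ Real.exp (L t * d t ω)} ≤ δ / T := by
      have h4 := h1.trans h2
      rw [Real.exp_add, mul_assoc] at h4
      have h5 := le_of_mul_le_mul_left (h4.trans_eq (mul_one _).symm) (Real.exp_pos M)
      rw [hΛ, Real.exp_log (by positivity)] at h5
      rw [le_div_iff₀ hTpos]
      rw [div_mul_eq_mul_div, div_le_iff₀ hδ] at h5
      rw [hΛ, Real.exp_add M, Real.exp_log (by positivity)]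
      linarith
    have h6 : P {ω | x < d t ω} ≤ P {ω | Real.exp (M + Λ) ≤ Real.exp (L t * d t ω)} := by
      apply measure_mono
      intro ω hω
      have hω' : x < d t ω := hω
      have hx0 : 0 ≤ x := by positivity
      refine Real.exp_le_exp.2 ?_
      calc M + Λ ≤ (1 + M) * Λ := by nlinarith
        _ = l0 / 2 * x := by rw [hx]; field_simp
        _ ≤ L t * d t ω := by
          have := hLpos t
          gcongr
          exact hLge t
    refine h6.trans ?_
    rw [← ENNReal.ofReal_toReal (measure_ne_top P _)]
    exact ENNReal.ofReal_le_ofReal h3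
  have hunion : P (⋃ t ∈ Finset.Icc 1 T, {ω | x < d t ω}) ≤ ENNReal.ofReal δ := by
    refine (measure_biUnion_finset_le _ _).trans ((Finset.sum_le_sum hbad).trans ?_)
    rw [Finset.sum_const, Nat.card_Icc, nsmul_eq_mul, ← ENNReal.ofReal_natCast,
      ← ENNReal.ofReal_mul (by positivity)]
    apply ENNReal.ofReal_le_ofReal
    simp only [Nat.add_sub_cancel]
    rw [mul_div_cancel₀ _ hTpos.ne']
  set good := {ω | ∀ t ∈ Finset.Icc 1 T,
    ‖μ t ω - μstar‖ ^ 2 ≤ 2 / σΨ * (2 / l0 * (1 + M)) * Λ} with hgood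
  have hcover : (Set.univ : Set Ω) ⊆ good ∪ ⋃ t ∈ Finset.Icc 1 T, {ω | x < d t ω} := by
    intro ω _
    by_cases h : ω ∈ ⋃ t ∈ Finset.Icc 1 T, {ω | x < d t ω}
    · exact Or.inr h
    · refine Or.inl fun t ht => ?_
      have hle : d t ω ≤ x := by
        by_contra hcon
        exact h (Set.mem_biUnion (t := fun t => {ω | x < d t ω}) ht (not_le.1 hcon))
      have := hdnorm t (Finset.mem_Icc.1 ht).1 ω
      rw [norm_sub_rev]
      calc ‖μstar - μ t ω‖ ^ 2 ≤ 2 / σΨ * x := by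
            rw [div_mul_eq_mul_div, le_div_iff₀ hσΨ]
            linarith
        _ = _ := by rw [hx]; ring
  have htot : 1 ≤ P good + ENNReal.ofReal δ := by
    calc (1 : ENNReal) = P Set.univ := measure_univ.symm
      _ ≤ P (good ∪ ⋃ t ∈ Finset.Icc 1 T, {ω | x < d t ω}) := measure_mono hcover
      _ ≤ P good + P (⋃ t ∈ Finset.Icc 1 T, {ω | x < d t ω}) := measure_union_le _ _
      _ ≤ _ := by gcongr
  rw [ENNReal.ofReal_sub _ hδ.le, ENNReal.ofReal_one]
  exact tsub_le_iff_right.2 htot
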